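/- arXiv:2106.04019 — 2 statements merged into one kernel-verified Lean document; each statement's English description precedes it below -/
import Mathlib

section
/- Fix a > 0, ξ₀ > 0, γ ∈ ℝ, and suppose λ : [−ξ₀, ξ₀] → ℂ satisfies λ_ξ = 1 + iγξ − (a² + γ²)ξ²/2 + O(|ξ|³) as ξ → 0. Then, after shrinking ξ₀, for all n ≥ 1 and all |s| < ξ₀ a √n one has |e^{−is√n γ/a} (λ_{s/(a√n)})ⁿ| ≤ e^{−s²/4}, and moreover for any C¹ function φ̂ on ℝ, the estimate |φ̂(s/(a√n)) e^{−is√nγ/a}(λ_{s/(a√n)})ⁿ − φ̂(0) e^{−s²/2}| ≤ (C/√n) ‖φ̂‖_{C¹} e^{−s²/4} holds for a constant C independent of s and n. -/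
open Filter Asymptotics

lemma aux_pow (x y : ℂ) (M d : ℝ) (hM : 0 ≤ M) (hx : ‖x‖ ≤ M) (hy : ‖y‖ ≤ M)
    (hd : ‖x - y‖ ≤ d) (n : ℕ) : ‖x ^ n - y ^ n‖ * M ≤ n * M ^ n * d := by
  induction n with
  | zero => simp
  | succ n ih =>
    have h1 : x ^ (n + 1) - y ^ (n + 1) = x * (x ^ n - y ^ n) + (x - y) * y ^ n := by ring
    have h2 : ‖x ^ (n + 1) - y ^ (n + 1)‖ ≤ M * ‖x ^ n - y ^ n‖ + d * M ^ n := by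
      rw [h1]
      refine (norm_add_le _ _).trans ?_
      rw [norm_mul, norm_mul, norm_pow]
      have hd0 : 0 ≤ d := (norm_nonneg _).trans hd
      gcongr
    calc ‖x ^ (n + 1) - y ^ (n + 1)‖ * M ≤ (M * ‖x ^ n - y ^ n‖ + d * M ^ n) * M := by gcongr
      _ = M * (‖x ^ n - y ^ n‖ * M) + d * M ^ n * M := by ring
      _ ≤ M * (n * M ^ n * d) + d * M ^ n * M := by gcongr
      _ = _ := by push_cast; ring

lemma aux_exp (s : ℝ) : |s| * Real.exp (-s ^ 2 / 3) ≤ 289 * Real.exp (-s ^ 2 / 4) ∧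
    |s| ^ 3 * Real.exp (-s ^ 2 / 3) ≤ 289 * Real.exp (-s ^ 2 / 4) := by
  have h0 : Real.exp (-s ^ 2 / 4) = Real.exp (s ^ 2 / 12) * Real.exp (-s ^ 2 / 3) := by
    rw [← Real.exp_add]; congr 1; ring
  have h1 := Real.quadratic_le_exp_of_nonneg (x := s ^ 2 / 12) (by positivity)
  have hs : s ^ 2 = |s| ^ 2 := (sq_abs s).symm
  have hp := abs_nonneg s
  rw [h0, ← mul_assoc]
  rw [hs] at h1 ⊢
  constructor
  · gcongr
    nlinarith [sq_nonneg (|s| - 1), sq_nonneg (|s| ^ 2)]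
  · gcongr
    nlinarith [sq_nonneg (|s| - 1), sq_nonneg (|s| ^ 2), sq_nonneg (|s| ^ 2 - |s|)]

lemma aux_key (a γ : ℝ) (lam : ℝ → ℂ)
    (hexp : (fun ξ : ℝ => lam ξ -
        (1 + Complex.I * (γ : ℂ) * (ξ : ℂ) - ((a ^ 2 + γ ^ 2 : ℝ) : ℂ) * (ξ : ℂ) ^ 2 / 2))
      =O[nhds 0] fun ξ : ℝ => |ξ| ^ 3) :
    ∃ K > (0 : ℝ), ∃ δ > (0 : ℝ), ∀ ξ : ℝ, |ξ| < δ →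
      ‖Complex.exp (-(Complex.I * γ * ξ)) * lam ξ - Complex.exp (-(a ^ 2 * ξ ^ 2 / 2 : ℝ))‖
        ≤ K * |ξ| ^ 3 := by
  obtain ⟨K0, hK0, h⟩ := hexp.exists_pos
  rw [IsBigOWith, Metric.eventually_nhds_iff] at h
  obtain ⟨δ0, hδ0, h⟩ := h
  set L : ℝ := |γ| + a ^ 2 + 1 with hL
  have hLp : 1 ≤ L := by have := abs_nonneg γ; nlinarith [sq_nonneg a]
  refine ⟨K0 + L ^ 3 + |γ| * a ^ 2 / 2 + a ^ 4 / 8, by positivity, min δ0 (1 / L),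
    by positivity, fun ξ hξ => ?_⟩
  have hξ0 : |ξ| < δ0 := hξ.trans_le (min_le_left _ _)
  have hξL : |ξ| * L < 1 := by
    have := hξ.trans_le (min_le_right _ _)
    rwa [lt_div_iff₀ (by linarith)] at this
  have hp := abs_nonneg ξ
  have hξ1 : |ξ| ≤ 1 := by nlinarith
  have hl := h (y := ξ) (by simpa using hξ0)
  rw [Real.norm_of_nonneg (by positivity)] at hl
  set z : ℂ := Complex.I * γ * ξ - (a ^ 2 * ξ ^ 2 / 2 : ℝ) with hz
  have hzn : ‖z‖ ≤ L * |ξ| := by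
    refine (norm_sub_le _ _).trans ?_
    simp only [norm_mul, Complex.norm_I, Complex.norm_real, Real.norm_eq_abs, one_mul]
    rw [abs_of_nonneg (a := a ^ 2 * ξ ^ 2 / 2) (by positivity), ← sq_abs ξ]
    have : |ξ| ^ 2 ≤ |ξ| := by nlinarith
    have := mul_le_mul_of_nonneg_left this (sq_nonneg a)
    nlinarith [mul_nonneg (sq_nonneg a) hp]
  have hz1 : ‖z‖ ≤ 1 := by linarith
  have hez : ‖Complex.exp z - (1 + z + z ^ 2 / 2)‖ ≤ L ^ 3 * |ξ| ^ 3 := by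
    have := Complex.exp_bound hz1 (n := 3) (by norm_num)
    simp only [Finset.sum_range_succ, Finset.sum_range_zero] at this
    norm_num [Nat.factorial] at this
    refine this.trans ?_
    have h3 : ‖z‖ ^ 3 ≤ L ^ 3 * |ξ| ^ 3 := by
      rw [← mul_pow]; gcongr
    nlinarith [norm_nonneg z, pow_nonneg (norm_nonneg z) 3]
  have hrem : ‖(1 + z + z ^ 2 / 2) -
      (1 + Complex.I * (γ : ℂ) * (ξ : ℂ) - ((a ^ 2 + γ ^ 2 : ℝ) : ℂ) * (ξ : ℂ) ^ 2 / 2)‖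
      ≤ (|γ| * a ^ 2 / 2 + a ^ 4 / 8) * |ξ| ^ 3 := by
    have e : (1 + z + z ^ 2 / 2) -
      (1 + Complex.I * (γ : ℂ) * (ξ : ℂ) - ((a ^ 2 + γ ^ 2 : ℝ) : ℂ) * (ξ : ℂ) ^ 2 / 2)
      = ((a ^ 4 * ξ ^ 4 / 8 : ℝ) : ℂ) - Complex.I * ((γ * a ^ 2 / 2 * ξ ^ 3 : ℝ) : ℂ) := by
      rw [hz]; push_cast; ring_nf; rw [Complex.I_sq]; ring
    rw [e]
    refine (norm_sub_le _ _).trans ?_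
    simp only [norm_mul, Complex.norm_I, Complex.norm_real, Real.norm_eq_abs, one_mul, abs_mul,
      abs_div, abs_pow]
    norm_num
    have h4 : |ξ| ^ 4 ≤ |ξ| ^ 3 := pow_le_pow_of_le_one hp hξ1 (by norm_num)
    have h5 : |a| ^ 4 = a ^ 4 := by
      rw [← abs_pow]; exact abs_of_nonneg (by positivity)
    have h6 : ξ ^ 4 = |ξ| ^ 4 := by
      rw [← abs_pow]; exact (abs_of_nonneg (by positivity)).symm
    simp only [h5]
    have := mul_le_mul_of_nonneg_left h4 (show 0 ≤ a ^ 4 by positivity)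
    nlinarith
  have hfac : Complex.exp (-(Complex.I * γ * ξ)) * lam ξ -
      Complex.exp (-(a ^ 2 * ξ ^ 2 / 2 : ℝ)) =
      Complex.exp (-(Complex.I * γ * ξ)) * (lam ξ - Complex.exp z) := by
    rw [mul_sub, ← Complex.exp_add, hz]
    congr 2
    push_cast; ring
  have hu : ‖Complex.exp (-(Complex.I * γ * ξ))‖ = 1 := by
    rw [Complex.norm_exp]; simp
  rw [hfac, norm_mul, hu, one_mul]
  set P : ℂ := 1 + Complex.I * (γ : ℂ) * (ξ : ℂ) - ((a ^ 2 + γ ^ 2 : ℝ) : ℂ) * (ξ : ℂ) ^ 2 / 2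
  have e2 : lam ξ - Complex.exp z = (lam ξ - P) - (Complex.exp z - (1 + z + z ^ 2 / 2))
      - ((1 + z + z ^ 2 / 2) - P) := by ring
  rw [e2]
  have t1 := norm_sub_le ((lam ξ - P) - (Complex.exp z - (1 + z + z ^ 2 / 2)))
    ((1 + z + z ^ 2 / 2) - P)
  have t2 := norm_sub_le (lam ξ - P) (Complex.exp z - (1 + z + z ^ 2 / 2))
  linarith

set_option maxHeartbeats 2000000 in
/-- Quantitative key estimate in the LLT.  If
`λ_ξ = 1 + iγξ − (a²+γ²)ξ²/2 + O(|ξ|³)` as `ξ → 0`, then after shrinking `ξ₀` one has,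
for all `n ≥ 1` and `|s| < ξ₀ a √n`,
`|e^{−is√nγ/a} (λ_{s/(a√n)})ⁿ| ≤ e^{−s²/4}`, and for every `C¹` function `φ̂` with
`‖φ̂‖_{C¹} ≤ B`,
`|φ̂(s/(a√n)) e^{−is√nγ/a}(λ_{s/(a√n)})ⁿ − φ̂(0)e^{−s²/2}| ≤ (C/√n) B e^{−s²/4}`,
with `C` independent of `s` and `n`. -/
theorem stmt_16 (a ξ₀ γ : ℝ) (ha : 0 < a) (hξ₀ : 0 < ξ₀) (lam : ℝ → ℂ)
    (hexp : (fun ξ : ℝ => lam ξ -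
        (1 + Complex.I * (γ : ℂ) * (ξ : ℂ) - ((a ^ 2 + γ ^ 2 : ℝ) : ℂ) * (ξ : ℂ) ^ 2 / 2))
      =O[nhds 0] fun ξ : ℝ => |ξ| ^ 3) :
    ∃ ξ₁ : ℝ, 0 < ξ₁ ∧ ξ₁ ≤ ξ₀ ∧ ∃ C > (0 : ℝ),
      ∀ n : ℕ, 1 ≤ n → ∀ s : ℝ, |s| < ξ₁ * a * Real.sqrt n →
        ‖Complex.exp (-(Complex.I * (s : ℂ) * (Real.sqrt n : ℂ) * (γ : ℂ) / (a : ℂ))) *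
            lam (s / (a * Real.sqrt n)) ^ n‖ ≤ Real.exp (-s ^ 2 / 4) ∧
        ∀ (φ : ℝ → ℂ) (B : ℝ), ContDiff ℝ 1 φ →
          (∀ ξ, ‖φ ξ‖ ≤ B) → (∀ ξ, ‖deriv φ ξ‖ ≤ B) →
          ‖φ (s / (a * Real.sqrt n)) *
              Complex.exp (-(Complex.I * (s : ℂ) * (Real.sqrt n : ℂ) * (γ : ℂ) / (a : ℂ))) *
              lam (s / (a * Real.sqrt n)) ^ n -
            φ 0 * Complex.exp (-((s : ℂ) ^ 2) / 2)‖ ≤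
            C / Real.sqrt n * B * Real.exp (-s ^ 2 / 4) := by
  obtain ⟨K, hK, δ, hδ, key⟩ := aux_key a γ lam hexp
  set c : ℝ := Real.exp (-(a ^ 2) / 2) * a ^ 2 / 6 with hc
  have hcp : 0 < c := by positivity
  refine ⟨min (min ξ₀ δ) (min 1 (c / K)), by positivity,
    (min_le_left _ _).trans (min_le_left _ _),
    289 / a + 289 * K * Real.exp (a ^ 2 / 3) / a ^ 3, by positivity, ?_⟩
  intro n hn s hs
  have hn0 : (0 : ℝ) < n := by exact_mod_cast hn
  set r := Real.sqrt n with hr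
  have hrp : 0 < r := Real.sqrt_pos.mpr hn0
  have hr2 : r ^ 2 = n := Real.sq_sqrt hn0.le
  set ξ : ℝ := s / (a * r) with hξ
  have hsξ : s = a * r * ξ := by rw [hξ]; field_simp
  have habs : |s| = a * r * |ξ| := by
    rw [hsξ, abs_mul, abs_of_pos (by positivity : 0 < a * r)]
  have hlt : |ξ| < min (min ξ₀ δ) (min 1 (c / K)) := by
    rw [habs] at hs
    have : (a * r) * |ξ| < (a * r) * min (min ξ₀ δ) (min 1 (c / K)) := by linarith
    exact lt_of_mul_lt_mul_left this (by positivity)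
  have hξδ : |ξ| < δ := hlt.trans_le ((min_le_left _ _).trans (min_le_right _ _))
  have hξ1 : |ξ| < 1 := hlt.trans_le ((min_le_right _ _).trans (min_le_left _ _))
  have hξc : |ξ| * K < c := by
    have := hlt.trans_le ((min_le_right _ _).trans (min_le_right _ _))
    rwa [lt_div_iff₀ hK] at this
  have hp := abs_nonneg ξ
  have hsq : |ξ| ^ 2 = ξ ^ 2 := sq_abs ξ
  have hsqle : ξ ^ 2 ≤ 1 := by rw [← hsq]; nlinarith
  have hk := key ξ hξδ
  set x : ℂ := Complex.exp (-(Complex.I * γ * ξ)) * lam ξ with hx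
  set y : ℂ := Complex.exp (-(a ^ 2 * ξ ^ 2 / 2 : ℝ)) with hy
  set M : ℝ := Real.exp (-(a ^ 2 * ξ ^ 2 / 3)) with hM
  have hMp : 0 < M := Real.exp_pos _
  have hyn : ‖y‖ = Real.exp (-(a ^ 2 * ξ ^ 2 / 2)) := by
    rw [hy, Complex.norm_exp, ← Complex.ofReal_neg, Complex.ofReal_re]
  have hyM : ‖y‖ ≤ M := by
    rw [hyn, hM]; apply Real.exp_le_exp.mpr; nlinarith [mul_nonneg (sq_nonneg a) (sq_nonneg ξ)]
  have hgap : Real.exp (-(a ^ 2 * ξ ^ 2 / 2)) + K * |ξ| ^ 3 ≤ M := by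
    have e : M = Real.exp (-(a ^ 2 * ξ ^ 2 / 2)) * Real.exp (a ^ 2 * ξ ^ 2 / 6) := by
      rw [hM, ← Real.exp_add]; congr 1; ring
    have h1 := Real.add_one_le_exp (a ^ 2 * ξ ^ 2 / 6)
    have h2 : Real.exp (-(a ^ 2) / 2) ≤ Real.exp (-(a ^ 2 * ξ ^ 2 / 2)) := by
      apply Real.exp_le_exp.mpr; nlinarith [sq_nonneg a]
    have h3 : K * |ξ| ^ 3 ≤ c * ξ ^ 2 := by
      have : K * |ξ| ^ 3 = (|ξ| * K) * ξ ^ 2 := by rw [← hsq]; ring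
      rw [this]; gcongr
    have h4 : c * ξ ^ 2 ≤ Real.exp (-(a ^ 2 * ξ ^ 2 / 2)) * (a ^ 2 * ξ ^ 2 / 6) := by
      have : c * ξ ^ 2 = Real.exp (-(a ^ 2) / 2) * (a ^ 2 * ξ ^ 2 / 6) := by rw [hc]; ring
      rw [this]; gcongr
    have h5 := mul_le_mul_of_nonneg_left h1 (Real.exp_pos (-(a ^ 2 * ξ ^ 2 / 2))).le
    rw [e]; linarith
  have hxM : ‖x‖ ≤ M := by
    have := norm_le_norm_add_norm_sub' x y
    linarith
  have hs2 : (n : ℝ) * (a ^ 2 * ξ ^ 2) = s ^ 2 := by rw [hsξ, ← hr2]; ring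
  have hMn : M ^ n = Real.exp (-s ^ 2 / 3) := by
    rw [hM, ← Real.exp_nat_mul, ← hs2]; congr 1; ring
  have hyn' : y ^ n = Complex.exp (-((s : ℂ) ^ 2) / 2) := by
    rw [hy, ← Complex.exp_nat_mul, ← Complex.ofReal_pow, ← hs2]; congr 1; push_cast; ring
  have hpow : Complex.exp (-(Complex.I * (s : ℂ) * (r : ℂ) * (γ : ℂ) / (a : ℂ))) *
      lam ξ ^ n = x ^ n := by
    rw [hx, mul_pow, ← Complex.exp_nat_mul]
    congr 2
    have : (n : ℂ) = (r : ℂ) ^ 2 := by rw [← Complex.ofReal_pow, hr2]; simp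
    have ha' : (a : ℂ) ≠ 0 := by exact_mod_cast ha.ne'
    rw [this, hsξ]; push_cast; field_simp
  have hxn : ‖x ^ n‖ ≤ Real.exp (-s ^ 2 / 3) := by
    rw [norm_pow, ← hMn]; gcongr
  constructor
  · rw [hpow]
    refine hxn.trans (Real.exp_le_exp.mpr ?_)
    nlinarith [sq_nonneg s]
  · intro φ B hφ hB hB'
    have hB0 : 0 ≤ B := (norm_nonneg _).trans (hB 0)
    have hlip : ‖φ ξ - φ 0‖ ≤ B * |ξ| := by
      have := Convex.norm_image_sub_le_of_norm_deriv_le (𝕜 := ℝ) (f := φ) (C := B)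
        (s := Set.univ) (x := 0) (y := ξ)
        (fun t _ => (hφ.differentiable (by norm_num)) t) (fun t _ => hB' t) convex_univ
        (Set.mem_univ _) (Set.mem_univ _)
      simpa using this
    have hd := aux_pow x y M _ hMp.le hxM hyM hk n
    have hMi : 1 ≤ M * Real.exp (a ^ 2 / 3) := by
      rw [hM, ← Real.exp_add]; apply Real.one_le_exp; nlinarith [sq_nonneg a]
    have hξs : |ξ| = |s| / (a * r) := by rw [habs]; field_simp
    obtain ⟨E1, E2⟩ := aux_exp s
    have hxy : ‖x ^ n - y ^ n‖ ≤ 289 * K * Real.exp (a ^ 2 / 3) / a ^ 3 / r *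
        Real.exp (-s ^ 2 / 4) := by
      calc ‖x ^ n - y ^ n‖ ≤ ‖x ^ n - y ^ n‖ * (M * Real.exp (a ^ 2 / 3)) :=
            le_mul_of_one_le_right (norm_nonneg _) hMi
        _ = (‖x ^ n - y ^ n‖ * M) * Real.exp (a ^ 2 / 3) := by ring
        _ ≤ (n * M ^ n * (K * |ξ| ^ 3)) * Real.exp (a ^ 2 / 3) := by gcongr
        _ = K * Real.exp (a ^ 2 / 3) / a ^ 3 / r * (|s| ^ 3 * Real.exp (-s ^ 2 / 3)) := by
            rw [hMn, hξs, ← hr2]; field_simp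
        _ ≤ K * Real.exp (a ^ 2 / 3) / a ^ 3 / r * (289 * Real.exp (-s ^ 2 / 4)) := by gcongr
        _ = _ := by ring
    have h1 : ‖(φ ξ - φ 0) * x ^ n‖ ≤ 289 / a / r * B * Real.exp (-s ^ 2 / 4) := by
      rw [norm_mul]
      calc ‖φ ξ - φ 0‖ * ‖x ^ n‖ ≤ B * |ξ| * Real.exp (-s ^ 2 / 3) := by gcongr
        _ = B / (a * r) * (|s| * Real.exp (-s ^ 2 / 3)) := by rw [hξs]; ring
        _ ≤ B / (a * r) * (289 * Real.exp (-s ^ 2 / 4)) := by gcongr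
        _ = _ := by field_simp
    have h2 : ‖φ 0 * (x ^ n - y ^ n)‖ ≤ B * (289 * K * Real.exp (a ^ 2 / 3) / a ^ 3 / r *
        Real.exp (-s ^ 2 / 4)) := by
      rw [norm_mul]
      exact mul_le_mul (hB 0) hxy (norm_nonneg _) hB0
    rw [mul_assoc, hpow, ← hyn']
    have e : φ ξ * x ^ n - φ 0 * y ^ n = (φ ξ - φ 0) * x ^ n + φ 0 * (x ^ n - y ^ n) := by ring
    rw [e]
    refine (norm_add_le _ _).trans ((add_le_add h1 h2).trans (le_of_eq ?_))
    ring
end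

section
/- Let f : ℝ² → ℝ be a C³ function supported in [−7/8, 7/8]² with ‖f‖_{C³} ≤ 1. Then for every ε > 0 there exist N_ε ∈ ℕ depending only on ε and smooth functions φ^±_{ε,i}, ψ^±_{ε,i} (1 ≤ i ≤ N_ε) supported in [−1,1] with C¹-norms at most 1 such that f^±_ε(u,v) := Σ_{i=1}^{N_ε} φ^±_{ε,i}(u) ψ^±_{ε,i}(v) satisfy f⁻_ε ≤ f ≤ f⁺_ε and ‖f − f^±_ε‖_∞ ≤ ε. -/
theorem aux_partition (δ : ℝ) (hδ : 0 < δ) : ∃ (n : ℕ) (θ : Fin n → ℝ → ℝ) (x : Fin n → ℝ) (M : ℝ),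
    0 < M ∧ (∀ j, ContDiff ℝ (⊤ : ℕ∞) (θ j)) ∧ (∀ j, Function.support (θ j) ⊆ Set.Icc (-1 : ℝ) 1) ∧
    (∀ j u, 0 ≤ θ j u) ∧ (∀ u, ∑ j, θ j u ≤ 1) ∧
    (∀ u ∈ Set.Icc (-(7 : ℝ)/8) (7/8), ∑ j, θ j u = 1) ∧
    (∀ j u, θ j u ≠ 0 → |u - x j| ≤ δ) ∧ (∀ j u, |θ j u| ≤ M) ∧ (∀ j u, |deriv (θ j) u| ≤ M) := by
  obtain ⟨m, hm⟩ := exists_nat_ge (max 8 (2 / δ))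
  have hm8 : (8 : ℝ) ≤ m := le_trans (le_max_left _ _) hm
  have hmd : 2 / δ ≤ (m : ℝ) := le_trans (le_max_right _ _) hm
  have hm0 : (0 : ℝ) < m := by linarith
  rw [div_le_iff₀ hδ] at hmd
  have hm8' : 8 ≤ m := by exact_mod_cast hm8
  let g := Real.smoothTransition
  let θ : ℕ → ℝ → ℝ := fun j u => g (m * (u + 1) - j) - g (m * (u + 1) - (j + 1 : ℕ))
  have hsm : ∀ j, ContDiff ℝ (⊤ : ℕ∞) (θ j) := by
    intro j
    have hg : ContDiff ℝ (⊤ : ℕ∞) g := Real.smoothTransition.contDiff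
    exact (hg.comp (by fun_prop)).sub (hg.comp (by fun_prop))
  have h0 : ∀ j u, 0 ≤ θ j u := by
    intro j u
    simp only [θ, g]
    push_cast
    rcases le_total ((m : ℝ) * (u + 1) - j) 1 with h | h
    · rw [Real.smoothTransition.zero_of_nonpos (x := (m : ℝ) * (u + 1) - (j + 1)) (by linarith)]
      simpa using Real.smoothTransition.nonneg _
    · rw [Real.smoothTransition.one_of_one_le h]
      simpa using Real.smoothTransition.le_one _
  have hne : ∀ j u, θ j u ≠ 0 → (j : ℝ) ≤ m * (u + 1) ∧ m * (u + 1) ≤ j + 2 := by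
    intro j u h
    constructor
    · by_contra! hc
      apply h
      simp only [θ, g]
      push_cast
      rw [Real.smoothTransition.zero_of_nonpos, Real.smoothTransition.zero_of_nonpos] <;> linarith
    · by_contra! hc
      apply h
      simp only [θ, g]
      push_cast
      rw [Real.smoothTransition.one_of_one_le, Real.smoothTransition.one_of_one_le] <;> linarith
  have hsum : ∀ u, ∑ j : Fin (2 * m - 1), θ j u
      = g (m * (u + 1)) - g (m * (u + 1) - (2 * m - 1 : ℕ)) := by
    intro u
    rw [Fin.sum_univ_eq_sum_range (fun j => θ j u)]
    simp only [θ]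
    rw [Finset.sum_range_sub' (fun j : ℕ => g (m * (u + 1) - j))]
    simp
  have hcast : ((2 * m - 1 : ℕ) : ℝ) = 2 * m - 1 := by
    rw [Nat.cast_sub (by omega)]; push_cast; ring
  have hsupp : ∀ j : Fin (2 * m - 1), Function.support (θ j) ⊆ Set.Icc (-1 : ℝ) 1 := by
    intro j u hu
    obtain ⟨h1, h2⟩ := hne j u hu
    have hj : ((j : ℕ) : ℝ) + 1 ≤ (2 * m - 1 : ℕ) := by exact_mod_cast j.2
    rw [hcast] at hj
    have hj0 : (0 : ℝ) ≤ (j : ℕ) := Nat.cast_nonneg _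
    constructor <;> nlinarith
  have hle1 : ∀ u, ∑ j : Fin (2 * m - 1), θ j u ≤ 1 := by
    intro u
    rw [hsum]
    have := Real.smoothTransition.le_one (m * (u + 1))
    have := Real.smoothTransition.nonneg (m * (u + 1) - (2 * m - 1 : ℕ))
    simp only [g]; linarith
  have hθ1 : ∀ (j : Fin (2 * m - 1)) u, θ j u ≤ 1 := fun j u =>
    (Finset.single_le_sum (f := fun j : Fin (2 * m - 1) => θ j u) (fun i _ => h0 i u)
      (Finset.mem_univ j)).trans (hle1 u)
  have hder : ∀ j : Fin (2 * m - 1), ∃ C, ∀ u, |deriv (θ j) u| ≤ C := by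
    intro j
    have hc : HasCompactSupport (θ j) :=
      HasCompactSupport.of_support_subset_isCompact isCompact_Icc (hsupp j)
    have hd : Continuous (deriv (θ j)) := (hsm j).continuous_deriv (by simp)
    obtain ⟨C, hC⟩ := hc.deriv.exists_bound_of_continuous hd
    exact ⟨C, fun u => by simpa using hC u⟩
  choose C hC using hder
  have hC0 : ∀ j, 0 ≤ C j := fun j => (abs_nonneg _).trans (hC j 0)
  have hCs : 0 ≤ ∑ j, C j := Finset.sum_nonneg fun j _ => hC0 j
  refine ⟨2 * m - 1, fun j => θ j, fun j => (j : ℕ) / m - 1, 1 + ∑ j, C j, by linarith,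
    fun j => hsm j, hsupp, fun j u => h0 j u, hle1, ?_, ?_, ?_, ?_⟩
  · intro u hu
    rw [hsum]
    simp only [g]
    rw [Real.smoothTransition.one_of_one_le, Real.smoothTransition.zero_of_nonpos]
    · simp
    · rw [hcast]; nlinarith [hu.2]
    · nlinarith [hu.1]
  · intro j u h
    obtain ⟨h1, h2⟩ := hne j u h
    have e : u - ((j : ℕ) / m - 1 : ℝ) = (m * (u + 1) - (j : ℕ)) / m := by field_simp; ring
    rw [e, abs_of_nonneg (div_nonneg (by linarith) hm0.le), div_le_iff₀ hm0]
    linarith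
  · intro j u
    rw [abs_of_nonneg (h0 j u)]
    linarith [hθ1 j u]
  · intro j u
    have := Finset.single_le_sum (f := C) (fun i _ => hC0 i) (Finset.mem_univ j)
    linarith [hC j u]

/-- The splitting step, for arbitrary bounded coefficients. -/
theorem aux_coeff {n : ℕ} (θ : Fin n → ℝ → ℝ) (M K : ℝ) (hM : 0 < M)
    (hsm : ∀ j, ContDiff ℝ (⊤ : ℕ∞) (θ j))
    (hsupp : ∀ j, Function.support (θ j) ⊆ Set.Icc (-1 : ℝ) 1)
    (hb : ∀ j u, |θ j u| ≤ M) (hd : ∀ j u, |deriv (θ j) u| ≤ M) :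
    ∃ N : ℕ, ∀ c : Fin n → Fin n → ℝ, (∀ j k, |c j k| ≤ K) →
      ∃ φ ψ : Fin N → ℝ → ℝ, (∀ i,
        (ContDiff ℝ (⊤ : ℕ∞) (φ i) ∧ ContDiff ℝ (⊤ : ℕ∞) (ψ i) ∧
        Function.support (φ i) ⊆ Set.Icc (-1 : ℝ) 1 ∧ Function.support (ψ i) ⊆ Set.Icc (-1 : ℝ) 1 ∧
        (∀ u, |φ i u| ≤ 1) ∧ (∀ u, |deriv (φ i) u| ≤ 1) ∧
        (∀ u, |ψ i u| ≤ 1) ∧ (∀ u, |deriv (ψ i) u| ≤ 1))) ∧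
        ∀ u v, ∑ i, φ i u * ψ i v = ∑ j, ∑ k, c j k * (θ j u * θ k v) := by
  obtain ⟨L, hL⟩ := exists_nat_ge (max 1 (K * M * M))
  have hL1 : (1 : ℝ) ≤ L := le_trans (le_max_left _ _) hL
  have hLK : K * M * M ≤ (L : ℝ) := le_trans (le_max_right _ _) hL
  have hL0 : (0 : ℝ) < L := by linarith
  -- scaling lemma
  have key : ∀ (a : ℝ) (j : Fin n), |a| * M ≤ 1 →
      ContDiff ℝ (⊤ : ℕ∞) (fun u => a * θ j u) ∧
      Function.support (fun u => a * θ j u) ⊆ Set.Icc (-1 : ℝ) 1 ∧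
      (∀ u, |a * θ j u| ≤ 1) ∧ (∀ u, |deriv (fun u => a * θ j u) u| ≤ 1) := by
    intro a j ha
    refine ⟨contDiff_const.mul (hsm j), ?_, ?_, ?_⟩
    · intro u hu
      exact hsupp j (right_ne_zero_of_mul hu)
    · intro u
      rw [abs_mul]
      exact (mul_le_mul_of_nonneg_left (hb j u) (abs_nonneg a)).trans ha
    · intro u
      rw [deriv_const_mul_field, abs_mul]
      exact (mul_le_mul_of_nonneg_left (hd j u) (abs_nonneg a)).trans ha
  let ι := Fin n × Fin n × Fin L
  let e : ι ≃ Fin (Fintype.card ι) := Fintype.equivFin ι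
  refine ⟨Fintype.card ι, fun c hc => ?_⟩
  have h1 : |M⁻¹| * M ≤ 1 := by
    rw [abs_of_pos (inv_pos.2 hM), inv_mul_cancel₀ hM.ne']
  have h2 : ∀ j k, |c j k * M / L| * M ≤ 1 := by
    intro j k
    rw [abs_div, abs_mul, abs_of_pos hM, abs_of_pos hL0, div_mul_eq_mul_div, div_le_one hL0]
    refine le_trans ?_ hLK
    gcongr
    exact hc j k
  refine ⟨fun i u => M⁻¹ * θ (e.symm i).1 u,
    fun i u => (c (e.symm i).1 (e.symm i).2.1 * M / L) * θ (e.symm i).2.1 u, ?_, ?_⟩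
  · intro i
    obtain ⟨a1, a2, a3, a4⟩ := key _ (e.symm i).1 h1
    obtain ⟨b1, b2, b3, b4⟩ := key _ (e.symm i).2.1 (h2 (e.symm i).1 (e.symm i).2.1)
    exact ⟨a1, b1, a2, b2, a3, a4, b3, b4⟩
  · intro u v
    rw [Equiv.sum_comp e.symm (fun p : ι => M⁻¹ * θ p.1 u * (c p.1 p.2.1 * M / L * θ p.2.1 v))]
    simp only [ι, Fintype.sum_prod_type]
    refine Finset.sum_congr rfl fun j _ => Finset.sum_congr rfl fun k _ => ?_
    simp only [Finset.sum_const, Finset.card_univ, Fintype.card_fin, nsmul_eq_mul]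
    field_simp

/-- The approximation estimate. -/
theorem aux_est {n : ℕ} (θ : Fin n → ℝ → ℝ) (x : Fin n → ℝ) (δ : ℝ) (hδ : 0 < δ)
    (h0 : ∀ j u, 0 ≤ θ j u) (h1 : ∀ u, ∑ j, θ j u ≤ 1)
    (heq : ∀ u ∈ Set.Icc (-(7 : ℝ)/8) (7/8), ∑ j, θ j u = 1)
    (hx : ∀ j u, θ j u ≠ 0 → |u - x j| ≤ δ)
    (f : ℝ × ℝ → ℝ)
    (hs : Function.support f ⊆ Set.Icc (-(7 : ℝ)/8) (7/8) ×ˢ Set.Icc (-(7 : ℝ)/8) (7/8))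
    (hf : ∀ p q, |f p - f q| ≤ ‖p - q‖) (s a b : ℝ) (ha : a ≤ 0) (hb : 0 ≤ b)
    (hsa : a ≤ s - δ) (hsb : s + δ ≤ b) (u v : ℝ) :
    a ≤ ∑ j, ∑ k, (f (x j, x k) + s) * (θ j u * θ k v) - f (u, v) ∧
    ∑ j, ∑ k, (f (x j, x k) + s) * (θ j u * θ k v) - f (u, v) ≤ b := by
  have hfe : f (u, v) = ∑ j, ∑ k, f (u, v) * (θ j u * θ k v) := by
    have : ∑ j, ∑ k, f (u, v) * (θ j u * θ k v) = f (u, v) * ((∑ j, θ j u) * ∑ k, θ k v) := by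
      rw [Finset.sum_mul_sum, Finset.mul_sum]
      simp only [Finset.mul_sum]
    rw [this]
    by_cases h : f (u, v) = 0
    · simp [h]
    · have hm := hs (Function.mem_support.2 h)
      rw [heq u hm.1, heq v hm.2]; ring
  have hdiff : ∑ j, ∑ k, (f (x j, x k) + s) * (θ j u * θ k v) - f (u, v)
      = ∑ j, ∑ k, (f (x j, x k) - f (u, v) + s) * (θ j u * θ k v) := by
    conv_lhs => rw [hfe]
    simp only [← Finset.sum_sub_distrib]
    refine Finset.sum_congr rfl fun j _ => Finset.sum_congr rfl fun k _ => ?_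
    ring
  have hS0 : 0 ≤ (∑ j, θ j u) * ∑ k, θ k v :=
    mul_nonneg (Finset.sum_nonneg fun j _ => h0 j u) (Finset.sum_nonneg fun j _ => h0 j v)
  have hS1 : (∑ j, θ j u) * ∑ k, θ k v ≤ 1 :=
    mul_le_one₀ (h1 u) (Finset.sum_nonneg fun j _ => h0 j v) (h1 v)
  have hconst : ∀ r : ℝ, ∑ j, ∑ k, r * (θ j u * θ k v) = r * ((∑ j, θ j u) * ∑ k, θ k v) := by
    intro r
    rw [Finset.sum_mul_sum, Finset.mul_sum]
    simp only [Finset.mul_sum]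
  have hterm : ∀ j k, a * (θ j u * θ k v) ≤ (f (x j, x k) - f (u, v) + s) * (θ j u * θ k v) ∧
      (f (x j, x k) - f (u, v) + s) * (θ j u * θ k v) ≤ b * (θ j u * θ k v) := by
    intro j k
    have hnn := mul_nonneg (h0 j u) (h0 k v)
    by_cases hj : θ j u = 0
    · simp [hj]
    by_cases hk : θ k v = 0
    · simp [hk]
    have h := hf (x j, x k) (u, v)
    have hn : ‖((x j, x k) : ℝ × ℝ) - (u, v)‖ ≤ δ := by
      rw [Prod.norm_def]
      refine max_le ?_ ?_
      · simpa [abs_sub_comm] using hx j u hj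
      · simpa [abs_sub_comm] using hx k v hk
    have h' := abs_le.1 (h.trans hn)
    constructor
    · exact mul_le_mul_of_nonneg_right (by linarith) hnn
    · exact mul_le_mul_of_nonneg_right (by linarith) hnn
  rw [hdiff]
  constructor
  · calc a ≤ a * ((∑ j, θ j u) * ∑ k, θ k v) := by nlinarith
      _ = _ := (hconst a).symm
      _ ≤ _ := Finset.sum_le_sum fun j _ => Finset.sum_le_sum fun k _ => (hterm j k).1
  · calc _ ≤ ∑ j, ∑ k, b * (θ j u * θ k v) :=
          Finset.sum_le_sum fun j _ => Finset.sum_le_sum fun k _ => (hterm j k).2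
      _ = _ := hconst b
      _ ≤ b := by nlinarith

/-- Let `f : ℝ² → ℝ` be `C³`, supported in `[−7/8, 7/8]²`, with `‖f‖_{C³} ≤ 1`.  For every
`ε > 0` there exist `N_ε` (depending only on `ε`) and smooth functions `φ^±_{ε,i}`,
`ψ^±_{ε,i}` (`1 ≤ i ≤ N_ε`), supported in `[−1,1]` with `C¹`-norms at most `1`, such that
`f^±_ε(u,v) = Σ_i φ^±_{ε,i}(u) ψ^±_{ε,i}(v)` satisfy `f⁻_ε ≤ f ≤ f⁺_ε` and
`‖f − f^±_ε‖_∞ ≤ ε`. -/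
theorem stmt_19 :
    ∀ ε > (0 : ℝ), ∃ N : ℕ,
      ∀ f : ℝ × ℝ → ℝ, ContDiff ℝ 3 f →
        Function.support f ⊆ Set.Icc (-(7 : ℝ)/8) (7/8) ×ˢ Set.Icc (-(7 : ℝ)/8) (7/8) →
        (∀ k : ℕ, k ≤ 3 → ∀ x, ‖iteratedFDeriv ℝ k f x‖ ≤ 1) →
        ∃ φp φm ψp ψm : Fin N → ℝ → ℝ,
          (∀ i, ContDiff ℝ (⊤ : ℕ∞) (φp i) ∧ ContDiff ℝ (⊤ : ℕ∞) (φm i) ∧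
                ContDiff ℝ (⊤ : ℕ∞) (ψp i) ∧ ContDiff ℝ (⊤ : ℕ∞) (ψm i)) ∧
          (∀ i, Function.support (φp i) ⊆ Set.Icc (-1 : ℝ) 1 ∧
                Function.support (φm i) ⊆ Set.Icc (-1 : ℝ) 1 ∧
                Function.support (ψp i) ⊆ Set.Icc (-1 : ℝ) 1 ∧
                Function.support (ψm i) ⊆ Set.Icc (-1 : ℝ) 1) ∧
          (∀ i, (∀ u, |φp i u| ≤ 1) ∧ (∀ u, |deriv (φp i) u| ≤ 1) ∧
                (∀ u, |φm i u| ≤ 1) ∧ (∀ u, |deriv (φm i) u| ≤ 1) ∧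
                (∀ u, |ψp i u| ≤ 1) ∧ (∀ u, |deriv (ψp i) u| ≤ 1) ∧
                (∀ u, |ψm i u| ≤ 1) ∧ (∀ u, |deriv (ψm i) u| ≤ 1)) ∧
          (∀ u v : ℝ,
            (∑ i, φm i u * ψm i v) ≤ f (u, v) ∧
            f (u, v) ≤ ∑ i, φp i u * ψp i v) ∧
          (∀ u v : ℝ,
            |f (u, v) - ∑ i, φp i u * ψp i v| ≤ ε ∧
            |f (u, v) - ∑ i, φm i u * ψm i v| ≤ ε) := by
  intro ε hε
  obtain ⟨n, θ, x, M, hM, hsm, hsupp, h0, h1, heq, hx, hb, hd⟩ :=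
    aux_partition (ε / 2) (by linarith)
  obtain ⟨N, hN⟩ := aux_coeff θ M (1 + ε / 2) hM hsm hsupp hb hd
  refine ⟨N, fun f hf hs hder => ?_⟩
  have hbd : ∀ p, |f p| ≤ 1 := fun p => by
    have := hder 0 (by norm_num) p
    rwa [norm_iteratedFDeriv_zero] at this
  have hlip : ∀ p q, |f p - f q| ≤ ‖p - q‖ := by
    intro p q
    have := Convex.norm_image_sub_le_of_norm_fderiv_le (𝕜 := ℝ) (f := f) (C := 1) (s := Set.univ)
      (x := q) (y := p) (fun z _ => (hf.differentiable (by norm_num)) z)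
      (fun z _ => by
        have := hder 1 (by norm_num) z
        rwa [norm_iteratedFDeriv_one] at this) convex_univ (Set.mem_univ _) (Set.mem_univ _)
    simpa using this
  have hcb : ∀ s : ℝ, |s| ≤ ε / 2 → ∀ j k, |f (x j, x k) + s| ≤ 1 + ε / 2 := fun s hs j k =>
    (abs_add_le _ _).trans (add_le_add (hbd _) hs)
  obtain ⟨φp, ψp, hp, hps⟩ := hN (fun j k => f (x j, x k) + ε / 2)
    (hcb _ (by rw [abs_of_pos (by linarith)]))
  obtain ⟨φm, ψm, hm, hms⟩ := hN (fun j k => f (x j, x k) + -(ε / 2))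
    (hcb _ (by rw [abs_neg, abs_of_pos (by linarith)]))
  have ep := aux_est θ x (ε / 2) (by linarith) h0 h1 heq hx f hs hlip (ε / 2) 0 ε
    le_rfl hε.le (by linarith) (by linarith)
  have em := aux_est θ x (ε / 2) (by linarith) h0 h1 heq hx f hs hlip (-(ε / 2)) (-ε) 0
    (by linarith) le_rfl (by linarith) (by linarith)
  refine ⟨φp, φm, ψp, ψm, ?_, ?_, ?_, ?_, ?_⟩
  · intro i
    obtain ⟨a1, a2, -⟩ := hp i
    obtain ⟨b1, b2, -⟩ := hm i
    exact ⟨a1, b1, a2, b2⟩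
  · intro i
    obtain ⟨-, -, a1, a2, -⟩ := hp i
    obtain ⟨-, -, b1, b2, -⟩ := hm i
    exact ⟨a1, b1, a2, b2⟩
  · intro i
    obtain ⟨-, -, -, -, a1, a2, a3, a4⟩ := hp i
    obtain ⟨-, -, -, -, b1, b2, b3, b4⟩ := hm i
    exact ⟨a1, a2, b1, b2, a3, a4, b3, b4⟩
  · intro u v
    rw [hps, hms]
    have := ep u v
    have := em u v
    constructor <;> linarith
  · intro u v
    rw [hps, hms]
    have := ep u v
    have := em u v
    constructor <;> rw [abs_le] <;> constructor <;> linarith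
end
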